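/- arXiv:1409.7321 — 2 statements merged into one kernel-verified Lean document; each statement's English description precedes it below -/
import Mathlib

section
/- For every integer N ≥ 5, the function w₀ Z₀ is integrable on ℝ^N and ∫_{ℝ^N} w₀(ξ) Z₀(ξ) dξ = − ∫_{ℝ^N} w₀(ξ)² dξ; in particular this integral is strictly negative. -/
noncomputable section
open Real MeasureTheory

/-- The standard bubble `w₀(ξ) = α_N (1+|ξ|²)^{-(N-2)/2}` with `α_N = (N(N-2))^{(N-2)/4}`. -/
def bubble (N : ℕ) (ξ : EuclideanSpace ℝ (Fin N)) : ℝ :=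
  ((N : ℝ) * ((N : ℝ) - 2)) ^ (((N : ℝ) - 2) / 4) * (1 + ‖ξ‖ ^ 2) ^ (-(((N : ℝ) - 2) / 2))

/-- `Z₀(ξ) = ξ·∇w₀(ξ) + ((N-2)/2) w₀(ξ)`. -/
def Z0 (N : ℕ) (ξ : EuclideanSpace ℝ (Fin N)) : ℝ :=
  fderiv ℝ (bubble N) ξ ξ + ((N : ℝ) - 2) / 2 * bubble N ξ

lemma base_pos' (r : ℝ) : (0:ℝ) < 1 + r ^ 2 := by positivity

lemma H_alg (p r : ℝ) : r ^ 2 * (1 + r ^ 2) ^ (-p - 1) = (1 + r ^ 2) ^ (-p) - (1 + r ^ 2) ^ (-p-1) := by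
  have h : (1 + r ^ 2) ^ (-p) = (1 + r ^ 2) ^ (-p-1) * (1 + r^2) := by
    rw [← rpow_add_one (base_pos' r).ne']; congr 1; ring
  rw [h]; ring

lemma integ (N : ℕ) (q : ℝ) (hq : (N:ℝ) < 2 * q) :
    Integrable (fun x : EuclideanSpace ℝ (Fin N) => (1 + ‖x‖ ^ 2) ^ (-q)) := by
  have := integrable_rpow_neg_one_add_norm_sq (E := EuclideanSpace ℝ (Fin N)) (μ := volume)
    (r := 2 * q) (by simpa using hq)
  convert this using 3
  ring

def HH (N : ℕ) (r : ℝ) : ℝ :=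
  (N:ℝ) * (1 + r^2) ^ (-((N:ℝ)-2)) - 2 * ((N:ℝ)-2) * (r^2 * (1 + r^2) ^ (-((N:ℝ)-2)-1))

lemma HH_integ (N : ℕ) (hN : 5 ≤ N) :
    Integrable (fun x : EuclideanSpace ℝ (Fin N) => HH N ‖x‖) := by
  have h5 : (5:ℝ) ≤ N := by exact_mod_cast hN
  simp only [HH, H_alg]
  have h1 := integ N ((N:ℝ)-2) (by linarith)
  have h2 := integ N ((N:ℝ)-2+1) (by linarith)
  have e : -((N:ℝ)-2+1) = -((N:ℝ)-2)-1 := by ring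
  rw [e] at h2
  exact (h1.const_mul _).sub ((h1.sub h2).const_mul _)

lemma HH_deriv (N : ℕ) (hN : 5 ≤ N) (r : ℝ) :
    HasDerivAt (fun r : ℝ => r ^ N * (1 + r^2) ^ (-((N:ℝ)-2))) (r ^ (N-1) * HH N r) r := by
  have h1 : HasDerivAt (fun r : ℝ => 1 + r^2) (2 * r) r := by
    simpa using (hasDerivAt_pow 2 r).const_add 1
  have h2 := (hasDerivAt_pow N r).mul (h1.rpow_const (p := -((N:ℝ)-2)) (Or.inl (base_pos' r).ne'))
  refine h2.congr_deriv ?_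
  obtain ⟨k, rfl⟩ : ∃ k, N = k + 1 := ⟨N - 1, by omega⟩
  simp only [HH, Nat.add_sub_cancel]
  ring

lemma HH_tendsto (N : ℕ) (hN : 5 ≤ N) :
    Filter.Tendsto (fun r : ℝ => r ^ N * (1 + r^2) ^ (-((N:ℝ)-2))) Filter.atTop (nhds 0) := by
  have h5 : (5:ℝ) ≤ N := by exact_mod_cast hN
  have ht := tendsto_rpow_neg_atTop (y := (N:ℝ) - 4) (by linarith)
  refine squeeze_zero' ?_ ?_ ht
  · filter_upwards [Filter.eventually_gt_atTop 0] with r hr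
    positivity
  · filter_upwards [Filter.eventually_gt_atTop 0] with r hr
    have : (1 + r^2) ^ (-((N:ℝ)-2)) ≤ (r^2) ^ (-((N:ℝ)-2)) :=
      rpow_le_rpow_of_nonpos (by positivity) (by linarith) (by linarith)
    calc _ ≤ r ^ N * (r^2) ^ (-((N:ℝ)-2)) := by gcongr
      _ = _ := by
        rw [← rpow_natCast r N, ← rpow_natCast r 2, ← rpow_mul hr.le, ← rpow_add hr]
        congr 1; push_cast; ring

lemma HH_int (N : ℕ) (hN : 5 ≤ N) :
    ∫ x : EuclideanSpace ℝ (Fin N), HH N ‖x‖ = 0 := by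
  have : Nonempty (Fin N) := ⟨⟨0, by omega⟩⟩
  have hI := HH_integ N hN
  rw [integrable_fun_norm_addHaar] at hI
  rw [integral_fun_norm_addHaar]
  simp only [finrank_euclideanSpace, Fintype.card_fin, smul_eq_mul] at hI ⊢
  have := integral_Ioi_of_hasDerivAt_of_tendsto' (a := 0) (fun x _ => HH_deriv N hN x) hI (HH_tendsto N hN)
  rw [this]
  simp [show N ≠ 0 by omega]

lemma bubble_fderiv (N : ℕ) (ξ : EuclideanSpace ℝ (Fin N)) :
    fderiv ℝ (bubble N) ξ ξ = ((N : ℝ) * ((N : ℝ) - 2)) ^ (((N : ℝ) - 2) / 4) *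
      (-((N:ℝ)-2) * ‖ξ‖^2 * (1 + ‖ξ‖ ^ 2) ^ (-(((N : ℝ) - 2) / 2) - 1)) := by
  have h1 : HasFDerivAt (fun x : EuclideanSpace ℝ (Fin N) => 1 + ‖x‖^2) (2 • innerSL ℝ ξ) ξ :=
    ((hasStrictFDerivAt_norm_sq ξ).hasFDerivAt).const_add 1
  have h2 := (h1.rpow_const (p := -(((N : ℝ) - 2) / 2)) (Or.inl (base_pos' ‖ξ‖).ne')).const_mul
    (((N : ℝ) * ((N : ℝ) - 2)) ^ (((N : ℝ) - 2) / 4))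
  have h3 : HasFDerivAt (bubble N) _ ξ := h2
  rw [h3.fderiv]
  simp
  ring

lemma bubble_sq (N : ℕ) (ξ : EuclideanSpace ℝ (Fin N)) :
    bubble N ξ ^ 2 = (((N : ℝ) * ((N : ℝ) - 2)) ^ (((N : ℝ) - 2) / 4))^2 *
      (1 + ‖ξ‖ ^ 2) ^ (-((N : ℝ) - 2)) := by
  rw [bubble, mul_pow, ← rpow_natCast ((1 + ‖ξ‖ ^ 2) ^ (-(((N : ℝ) - 2) / 2))) 2,
    ← rpow_mul (base_pos' _).le]
  congr 2; push_cast; ring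

lemma key (N : ℕ) (ξ : EuclideanSpace ℝ (Fin N)) :
    bubble N ξ * Z0 N ξ =
      (((N : ℝ) * ((N : ℝ) - 2)) ^ (((N : ℝ) - 2) / 4))^2 / 2 * HH N ‖ξ‖ - bubble N ξ ^ 2 := by
  have h : (1 + ‖ξ‖ ^ 2) ^ (-((N : ℝ) - 2) - 1) =
      (1 + ‖ξ‖ ^ 2) ^ (-(((N : ℝ) - 2) / 2)) * (1 + ‖ξ‖ ^ 2) ^ (-(((N : ℝ) - 2) / 2) - 1) := by
    rw [← rpow_add (base_pos' _)]; congr 1; ring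
  have h' : bubble N ξ * Z0 N ξ = bubble N ξ * fderiv ℝ (bubble N) ξ ξ
      + ((N : ℝ) - 2) / 2 * bubble N ξ ^ 2 := by rw [Z0]; ring
  rw [h', bubble_fderiv, bubble_sq, HH, h, bubble]
  ring

theorem statement6 (N : ℕ) (hN : 5 ≤ N) :
    Integrable (fun ξ : EuclideanSpace ℝ (Fin N) => bubble N ξ * Z0 N ξ) ∧
    (∫ ξ : EuclideanSpace ℝ (Fin N), bubble N ξ * Z0 N ξ)
      = -∫ ξ : EuclideanSpace ℝ (Fin N), bubble N ξ ^ 2 ∧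
    (∫ ξ : EuclideanSpace ℝ (Fin N), bubble N ξ * Z0 N ξ) < 0 := by
  have h5 : (5:ℝ) ≤ N := by exact_mod_cast hN
  have hsq : Integrable (fun ξ : EuclideanSpace ℝ (Fin N) => bubble N ξ ^ 2) := by
    simp only [bubble_sq]
    exact (integ N ((N:ℝ)-2) (by linarith)).const_mul _
  have hH := (HH_integ N hN).const_mul
    ((((N : ℝ) * ((N : ℝ) - 2)) ^ (((N : ℝ) - 2) / 4))^2 / 2)
  have heq : (∫ ξ : EuclideanSpace ℝ (Fin N), bubble N ξ * Z0 N ξ)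
      = -∫ ξ : EuclideanSpace ℝ (Fin N), bubble N ξ ^ 2 := by
    simp only [key]
    rw [integral_sub hH hsq, integral_const_mul, HH_int N hN]
    simp
  refine ⟨?_, heq, ?_⟩
  · simp only [key]
    exact hH.sub hsq
  · rw [heq, neg_lt_zero]
    have hpos : ∀ ξ : EuclideanSpace ℝ (Fin N), 0 < bubble N ξ ^ 2 := fun ξ => by
      have h1 : 0 < (N:ℝ) * ((N:ℝ) - 2) := mul_pos (by linarith) (by linarith)
      have := rpow_pos_of_pos (base_pos' ‖ξ‖) (-(((N : ℝ) - 2) / 2))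
      have := rpow_pos_of_pos h1 (((N : ℝ) - 2) / 4)
      unfold bubble
      positivity
    rw [integral_pos_iff_support_of_nonneg (fun ξ => (hpos ξ).le) hsq]
    have : Function.support (fun ξ : EuclideanSpace ℝ (Fin N) => bubble N ξ ^ 2) = Set.univ := by
      ext ξ; simpa using (hpos ξ).ne'
    rw [this]
    exact Measure.measure_univ_pos.2 (NeZero.ne _)
end
end

section
/- Let N ≥ 6 be an integer and let r be a real number with 4 < r < N. If u : ℝ^N \ {0} → ℝ is a C² function with Δu(x) = 0 for all x ≠ 0, and there exists a constant C > 0 such that |u(x)| ≤ C |x|^{2-r} for all x ≠ 0, then u ≡ 0 on ℝ^N \ {0}. -/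
noncomputable section
open Real

/-- The Euclidean Laplacian: sum of the pure second partial derivatives. -/
def lap {N : ℕ} (u : EuclideanSpace ℝ (Fin N) → ℝ) (x : EuclideanSpace ℝ (Fin N)) : ℝ :=
  ∑ i : Fin N,
    fderiv ℝ (fun y => fderiv ℝ u y (EuclideanSpace.single i 1)) x (EuclideanSpace.single i 1)

theorem aux_second (g g' : ℝ → ℝ) (c : ℝ) (hmax : IsLocalMax g 0)
    (h1 : ∀ᶠ t in nhds (0:ℝ), HasDerivAt g (g' t) t) (h2 : HasDerivAt g' c 0) : c ≤ 0 := by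
  by_contra hc
  push Not at hc
  have e1 : deriv g =ᶠ[nhds 0] g' := by
    filter_upwards [h1] with t ht using ht.deriv
  have e2 : deriv (deriv g) 0 = c := by rw [e1.deriv_eq]; exact h2.deriv
  have hmin := isLocalMin_of_deriv_deriv_pos (f := g) (x₀ := 0) (by rw [e2]; exact hc)
    hmax.deriv_eq_zero h1.self_of_nhds.continuousAt
  have e3 : g =ᶠ[nhds 0] fun _ => g 0 := by
    filter_upwards [hmin, hmax] with t h h' using le_antisymm h' h
  have e4 : deriv g =ᶠ[nhds 0] fun _ => 0 := by
    have := e3.deriv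
    simpa using this
  have e5 : deriv (deriv g) 0 = 0 := by rw [e4.deriv_eq]; simp
  linarith

theorem aux_normsq {N : ℕ} (x : EuclideanSpace ℝ (Fin N)) (i : Fin N) (t : ℝ) :
    ‖x + t • EuclideanSpace.single i (1:ℝ)‖ ^ 2 = ‖x‖ ^ 2 + 2 * t * x i + t ^ 2 := by
  rw [norm_add_sq_real, real_inner_smul_right, EuclideanSpace.inner_single_right, norm_smul]
  simp
  ring

theorem aux_max {N : ℕ} (u : EuclideanSpace ℝ (Fin N) → ℝ)
    (hu : ContDiffOn ℝ 2 u {(0 : EuclideanSpace ℝ (Fin N))}ᶜ) (b ε : ℝ)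
    (x : EuclideanSpace ℝ (Fin N)) (hx : x ≠ 0)
    (hmax : ∀ y, y ≠ 0 → u y - ε * (‖y‖ ^ 2) ^ (-b) ≤ u x - ε * (‖x‖ ^ 2) ^ (-b)) (i : Fin N) :
    fderiv ℝ (fun y => fderiv ℝ u y (EuclideanSpace.single i 1)) x (EuclideanSpace.single i 1)
      - ε * (-2 * b * (‖x‖ ^ 2) ^ (-b - 1) + 4 * b * (b + 1) * (x i) ^ 2 * (‖x‖ ^ 2) ^ (-b - 2))
      ≤ 0 := by
  set e : EuclideanSpace ℝ (Fin N) := EuclideanSpace.single i 1 with he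
  have hline : ∀ t : ℝ, HasDerivAt (fun t : ℝ => x + t • e) e t := fun t => by
    simpa using ((hasDerivAt_id t).smul_const e).const_add x
  have hne : ∀ᶠ t in nhds (0:ℝ), x + t • e ≠ 0 := by
    have : ContinuousAt (fun t : ℝ => x + t • e) 0 := (hline 0).continuousAt
    exact this.eventually_ne (by simpa using hx)
  have hcd : ∀ y : EuclideanSpace ℝ (Fin N), y ≠ 0 → ContDiffAt ℝ 2 u y := fun y hy =>
    hu.contDiffAt (isOpen_compl_singleton.mem_nhds hy)
  have hq : ∀ t : ℝ, HasDerivAt (fun t : ℝ => ‖x‖ ^ 2 + 2 * t * x i + t ^ 2) (2 * x i + 2 * t) t := by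
    intro t
    have := ((((hasDerivAt_id t).const_mul 2).mul_const (x i)).const_add (‖x‖^2)).add
      ((hasDerivAt_id t).pow 2)
    exact this.congr_deriv (by simp)
  have hs : 0 < ‖x‖ ^ 2 := by positivity
  refine aux_second (fun t => u (x + t • e) - ε * (‖x‖ ^ 2 + 2 * t * x i + t ^ 2) ^ (-b))
    (fun t => fderiv ℝ u (x + t • e) e
      - ε * ((2 * x i + 2 * t) * (-b) * (‖x‖ ^ 2 + 2 * t * x i + t ^ 2) ^ (-b - 1))) _ ?_ ?_ ?_
  · filter_upwards [hne] with t ht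
    have := hmax _ ht
    rw [aux_normsq] at this
    simpa using this
  · filter_upwards [hne] with t ht
    have hp : 0 < ‖x‖ ^ 2 + 2 * t * x i + t ^ 2 := by
      rw [← aux_normsq]; positivity
    have h1 : HasFDerivAt u (fderiv ℝ u (x + t • e)) (x + t • e) :=
      ((hcd _ ht).differentiableAt (by norm_num)).hasFDerivAt
    exact (h1.comp_hasDerivAt t (hline t)).sub
      (((hq t).rpow_const (Or.inl hp.ne')).const_mul ε)
  · have hd : DifferentiableAt ℝ (fun y => fderiv ℝ u y e) x := by
      have : DifferentiableAt ℝ (fderiv ℝ u) x :=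
        ((hcd x hx).fderiv_right (m := 1) (by norm_num)).differentiableAt (by norm_num)
      exact this.clm_apply (differentiableAt_const e)
    have h1 : HasFDerivAt (fun y => fderiv ℝ u y e) (fderiv ℝ (fun y => fderiv ℝ u y e) x)
      (x + (0:ℝ) • e) := by
      simpa using hd.hasFDerivAt
    have hl : HasDerivAt (fun t : ℝ => (2 * x i + 2 * t) * (-b)) (2 * (-b)) 0 := by
      simpa using (((hasDerivAt_id (0:ℝ)).const_mul 2).const_add (2 * x i)).mul_const (-b)
    have h2 := (hl.mul ((hq 0).rpow_const (p := -b - 1) (Or.inl (by simpa using hs.ne')))).const_mul ε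
    have h3 := (h1.comp_hasDerivAt (0:ℝ) (hline 0)).sub h2
    refine h3.congr_deriv ?_
    have : -b - 1 - 1 = -b - 2 := by ring
    rw [this]
    simp
    ring_nf
    simp

theorem aux_half (N : ℕ) (hN : 6 ≤ N) (r : ℝ) (hr4 : 4 < r) (hrN : r < N)
    (u : EuclideanSpace ℝ (Fin N) → ℝ)
    (hu : ContDiffOn ℝ 2 u {(0 : EuclideanSpace ℝ (Fin N))}ᶜ)
    (hharm : ∀ x : EuclideanSpace ℝ (Fin N), x ≠ 0 → lap u x = 0)
    (C : ℝ) (hC : 0 < C)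
    (hbd : ∀ x : EuclideanSpace ℝ (Fin N), x ≠ 0 → u x ≤ C * ‖x‖ ^ (2 - r)) :
    ∀ x : EuclideanSpace ℝ (Fin N), x ≠ 0 → u x ≤ 0 := by
  intro x1 hx1
  obtain ⟨b, hb⟩ : ∃ b : ℝ, b = (r + N - 4) / 4 := ⟨_, rfl⟩
  have hb0 : 0 < b := by rw [hb]; linarith
  have hbN : 2 * (b + 1) < N := by rw [hb]; linarith
  have hbr : 0 < 2 * b + 2 - r := by rw [hb]; linarith
  have key : ∀ ε : ℝ, 0 < ε → u x1 ≤ ε * ((‖x1‖ ^ 2) ^ (-b) + 1) := by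
    intro ε hε
    by_contra hcon
    push Not at hcon
    set V : EuclideanSpace ℝ (Fin N) → ℝ := fun y => u y - ε * (‖y‖ ^ 2) ^ (-b) with hV
    have hV1 : ε < V x1 := by simp only [hV]; linarith
    obtain ⟨ρ, hρ⟩ : ∃ ρ : ℝ, ρ = (ε / C) ^ (1 / (2 * b + 2 - r)) := ⟨_, rfl⟩
    obtain ⟨R, hR⟩ : ∃ R : ℝ, R = (C / ε) ^ (1 / (r - 2)) := ⟨_, rfl⟩
    have hρ0 : 0 < ρ := by rw [hρ]; positivity
    have hout : ∀ y, y ≠ 0 → ε < V y → ρ ≤ ‖y‖ ∧ ‖y‖ ≤ R := by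
      intro y hy hVy
      have hn : 0 < ‖y‖ := norm_pos_iff.mpr hy
      have hyb := hbd y hy
      simp only [hV] at hVy
      have hpw : (‖y‖ ^ 2) ^ (-b) = ‖y‖ ^ (-(2 * b)) := by
        rw [← Real.rpow_natCast, ← Real.rpow_mul hn.le]; congr 1; push_cast; ring
      have hpp : 0 < ‖y‖ ^ (-(2 * b)) := by positivity
      rw [hpw] at hVy
      constructor
      · have h1 : ε * ‖y‖ ^ (-(2 * b)) ≤ C * ‖y‖ ^ (2 - r) := by linarith
        have h2 : ‖y‖ ^ (2 - r) = ‖y‖ ^ (2 * b + 2 - r) * ‖y‖ ^ (-(2 * b)) := by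
          rw [← Real.rpow_add hn]; congr 1; ring
        rw [h2, ← mul_assoc] at h1
        have h3 := le_of_mul_le_mul_right h1 hpp
        have h4 : ε / C ≤ ‖y‖ ^ (2 * b + 2 - r) := by
          rw [div_le_iff₀ hC]; linarith
        rw [hρ]
        calc _ ≤ (‖y‖ ^ (2 * b + 2 - r)) ^ (1 / (2 * b + 2 - r)) :=
              Real.rpow_le_rpow (by positivity) h4 (by positivity)
          _ = ‖y‖ := by
              rw [← Real.rpow_mul hn.le, mul_one_div_cancel hbr.ne', Real.rpow_one]
      · have hr2 : 0 < r - 2 := by linarith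
        have h1 : ε ≤ C * ‖y‖ ^ (2 - r) := by nlinarith
        have h2 : ‖y‖ ^ (2 - r) = (‖y‖ ^ (r - 2))⁻¹ := by
          rw [← Real.rpow_neg hn.le]; congr 1; ring
        have h3 : ‖y‖ ^ (r - 2) ≤ C / ε := by
          rw [h2, ← div_eq_mul_inv, le_div_iff₀ (by positivity)] at h1
          rw [le_div_iff₀ hε]; linarith
        rw [hR]
        calc ‖y‖ = (‖y‖ ^ (r - 2)) ^ (1 / (r - 2)) := by
              rw [← Real.rpow_mul hn.le, mul_one_div_cancel hr2.ne', Real.rpow_one]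
          _ ≤ _ := Real.rpow_le_rpow (by positivity) h3 (by positivity)
    set K : Set (EuclideanSpace ℝ (Fin N)) := {y | ρ ≤ ‖y‖} ∩ Metric.closedBall 0 R with hK
    have hKc : IsCompact K := (isCompact_closedBall _ _).inter_left
      (isClosed_le continuous_const continuous_norm)
    have hK0 : ∀ y ∈ K, y ≠ 0 := fun y hy h0 => by
      have := hy.1
      simp only [Set.mem_ofPred_eq, h0, norm_zero] at this
      linarith
    have hKm : ∀ y, y ≠ 0 → ε < V y → y ∈ K := fun y hy h =>
      ⟨(hout y hy h).1, by simpa using (hout y hy h).2⟩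
    have hcont : ContinuousOn V K := by
      refine (hu.continuousOn.mono fun y hy => hK0 y hy).sub (continuousOn_const.mul ?_)
      exact ContinuousOn.rpow_const (by fun_prop)
        fun y hy => Or.inl (by have := hK0 y hy; positivity)
    obtain ⟨x0, hx0K, hx0⟩ := hKc.exists_isMaxOn ⟨x1, hKm x1 hx1 hV1⟩ hcont
    have hx00 := hK0 x0 hx0K
    have hVx0 : ε < V x0 := hV1.trans_le (hx0 (hKm x1 hx1 hV1))
    have hglob : ∀ y, y ≠ 0 → V y ≤ V x0 := by
      intro y hy
      by_cases h : ε < V y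
      · exact hx0 (hKm y hy h)
      · linarith
    have hsum := Finset.sum_nonpos fun i (_ : i ∈ Finset.univ) =>
      aux_max u hu b ε x0 hx00 hglob i
    rw [Finset.sum_sub_distrib] at hsum
    have hl := hharm x0 hx00
    unfold lap at hl
    rw [hl, ← Finset.mul_sum, Finset.sum_add_distrib, Finset.sum_const, ← Finset.sum_mul, ← Finset.mul_sum,
      ← EuclideanSpace.real_norm_sq_eq] at hsum
    have hs : 0 < ‖x0‖ ^ 2 := by positivity
    have hpw : (‖x0‖ ^ 2) ^ (-b - 1) = ‖x0‖ ^ 2 * (‖x0‖ ^ 2) ^ (-b - 2) := by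
      rw [show -b - 1 = 1 + (-b - 2) by ring, Real.rpow_add hs, Real.rpow_one]
    rw [hpw] at hsum
    simp only [Finset.card_univ, Fintype.card_fin, nsmul_eq_mul] at hsum
    have hp : 0 < ε * (2 * b) * (‖x0‖ ^ 2 * (‖x0‖ ^ 2) ^ (-b - 2)) := by positivity
    have := mul_pos hp (sub_pos.mpr hbN)
    linarith
  have hA : 0 < (‖x1‖ ^ 2) ^ (-b) + 1 := by positivity
  refine le_of_forall_pos_le_add fun δ hδ => ?_
  have := key (δ / ((‖x1‖ ^ 2) ^ (-b) + 1)) (by positivity)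
  rw [div_mul_cancel₀ _ hA.ne'] at this
  linarith

theorem statement13 (N : ℕ) (hN : 6 ≤ N) (r : ℝ) (hr4 : 4 < r) (hrN : r < N)
    (u : EuclideanSpace ℝ (Fin N) → ℝ)
    (hu : ContDiffOn ℝ 2 u {(0 : EuclideanSpace ℝ (Fin N))}ᶜ)
    (hharm : ∀ x : EuclideanSpace ℝ (Fin N), x ≠ 0 → lap u x = 0)
    (C : ℝ) (hC : 0 < C)
    (hbd : ∀ x : EuclideanSpace ℝ (Fin N), x ≠ 0 → |u x| ≤ C * ‖x‖ ^ (2 - r)) :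
    ∀ x : EuclideanSpace ℝ (Fin N), x ≠ 0 → u x = 0 := by
  intro x hx
  have h1 := aux_half N hN r hr4 hrN u hu hharm C hC
    (fun y hy => (le_abs_self _).trans (hbd y hy)) x hx
  have h2 := aux_half N hN r hr4 hrN (fun y => - u y) hu.neg
    (fun y hy => by
      have := hharm y hy
      unfold lap at this ⊢
      simp only [fderiv_fun_neg, neg_apply, Finset.sum_neg_distrib, this,
        neg_zero]) C hC
    (fun y hy => (neg_le_abs _).trans (hbd y hy)) x hx
  linarith
end
end
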